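/- Let Φ : c00 → c00 be a homogeneous map commuting with all sign sequences, i.e., Φ(ε·x) = ε·Φ(x) for every ε ∈ {−1,1}^ℕ and x ∈ c00. Suppose there exist a homogeneous map H₀ : c00 → ℓ₂ and a constant K₀ such that ‖H₀(x+x') − H₀(x) − H₀(x') − Φ(Ω(x+x') − Ω(x) − Ω(x'))‖₂ ≤ K₀(‖x‖₂ + ‖x'‖₂) for all x, x' ∈ c00, where Ω is the Kalton–Peck map. Then there exist a homogeneous support-preserving map H : c00 → ℓ₂ and a constant K such that whenever x, y ∈ c00 have disjoint supports and ‖x‖₂ = ‖y‖₂, one has ‖H(x+y) − H(x) − H(y) − Φ(x+y)‖₂ ≤ K‖x‖₂. -/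

import Mathlib

/-- `x : ℕ → ℝ` is finitely supported (i.e. belongs to `c00`). -/
def FinSupp (x : ℕ → ℝ) : Prop := (Function.support x).Finite

/-- The `ℓ₂` norm of a sequence, `‖x‖₂ = (∑ₙ |x n|²)^{1/2}`. -/
noncomputable def l2Norm (x : ℕ → ℝ) : ℝ := Real.sqrt (∑' n, (x n) ^ 2)

/-- `ε : ℕ → ℝ` is a sign sequence, i.e. an element of `{−1,1}^ℕ`. -/
def IsSign (ε : ℕ → ℝ) : Prop := ∀ n, ε n = 1 ∨ ε n = -1

/-- The Kalton–Peck map `Ω : c00 → c00`,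
`Ω(x)(n) = x n · log(‖x‖₂/|x n|)` when `x n ≠ 0` and `0` otherwise. -/
noncomputable def KP2 (x : ℕ → ℝ) : ℕ → ℝ :=
  fun n => if x n = 0 then 0 else x n * Real.log (l2Norm x / |x n|)

open Finset Function

/-- The sign sequence equal to `-1` on `A` and `1` elsewhere. -/
def flipSign (A : Finset ℕ) (n : ℕ) : ℝ := if n ∈ A then -1 else 1

lemma isSign_flipSign (A : Finset ℕ) : IsSign (flipSign A) := by
  intro n
  by_cases h : n ∈ A <;> simp [flipSign, h]

lemma flipSign_mul_self (A : Finset ℕ) (n : ℕ) : flipSign A n * flipSign A n = 1 := by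
  by_cases h : n ∈ A <;> simp [flipSign, h]

lemma flipSign_sq (A : Finset ℕ) (n : ℕ) : flipSign A n ^ 2 = 1 := by
  rw [sq, flipSign_mul_self]

lemma flipSign_insert_of_ne {A : Finset ℕ} {a n : ℕ} (h : n ≠ a) :
    flipSign (insert a A) n = flipSign A n := by
  simp [flipSign, h]

lemma flipSign_insert_mul {A : Finset ℕ} {a : ℕ} {x : ℕ → ℝ} (hx : x a = 0) :
    flipSign (insert a A) * x = flipSign A * x := by
  funext n
  by_cases h : n = a
  · subst h; simp [hx]
  · simp [flipSign_insert_of_ne h]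

lemma FinSupp.mul_left {x : ℕ → ℝ} (hx : FinSupp x) (ε : ℕ → ℝ) : FinSupp (ε * x) :=
  hx.subset (support_mul_subset_right ε x)

lemma FinSupp.add {x y : ℕ → ℝ} (hx : FinSupp x) (hy : FinSupp y) : FinSupp (x + y) :=
  (hx.union hy).subset (support_add x y)

lemma FinSupp.summable_sq {x : ℕ → ℝ} (hx : FinSupp x) : Summable fun n => x n ^ 2 :=
  summable_of_hasFiniteSupport (hx.subset fun n hn => by
    simpa [Function.mem_support] using hn)

lemma summable_sq_sub {f g : ℕ → ℝ} (hf : Summable fun n => f n ^ 2)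
    (hg : Summable fun n => g n ^ 2) : Summable fun n => (f n - g n) ^ 2 :=
  Summable.of_nonneg_of_le (fun n => sq_nonneg _)
    (fun n => by nlinarith [sq_nonneg (f n + g n)]) ((hf.mul_left 2).add (hg.mul_left 2))

lemma sum_sq_le_l2Norm_sq {f : ℕ → ℝ} (hf : Summable fun n => f n ^ 2) (S : Finset ℕ) :
    ∑ n ∈ S, f n ^ 2 ≤ l2Norm f ^ 2 := by
  rw [l2Norm, Real.sq_sqrt (tsum_nonneg fun n => sq_nonneg _)]
  exact hf.sum_le_tsum S fun n _ => sq_nonneg _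

lemma l2Norm_const_mul (c : ℝ) (f : ℕ → ℝ) :
    l2Norm (fun n => c * f n) = |c| * l2Norm f := by
  simp only [l2Norm, mul_pow, tsum_mul_left]
  rw [Real.sqrt_mul (sq_nonneg c), Real.sqrt_sq_eq_abs]

lemma l2Norm_sign_mul {ε : ℕ → ℝ} (hε : IsSign ε) (x : ℕ → ℝ) :
    l2Norm (ε * x) = l2Norm x := by
  unfold l2Norm
  congr 2
  funext n
  rcases hε n with h | h <;> simp [h]

/-- A map commuting with sign changes is support-preserving. -/
lemma eq_zero_of_commutes_signs {Φ : (ℕ → ℝ) → (ℕ → ℝ)}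
    (hΦ : ∀ ε x : ℕ → ℝ, IsSign ε → FinSupp x → Φ (ε * x) = ε * Φ x)
    {x : ℕ → ℝ} (hx : FinSupp x) {n : ℕ} (hn : x n = 0) : Φ x n = 0 := by
  have h := congrFun (hΦ (flipSign {n}) x (isSign_flipSign _) hx) n
  have hfix : flipSign {n} * x = x := by
    have := flipSign_insert_mul (A := ∅) hn
    rw [insert_empty_eq] at this
    rw [this]
    funext m
    simp [flipSign]
  rw [hfix] at h
  simp only [flipSign, Pi.mul_apply, Finset.mem_singleton, if_true] at h
  linarith

lemma l2Norm_add_of_disjoint {x y : ℕ → ℝ} (hx : FinSupp x) (hy : FinSupp y)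
    (hd : ∀ n, x n = 0 ∨ y n = 0) (hxy : l2Norm x = l2Norm y) :
    l2Norm (x + y) = Real.sqrt 2 * l2Norm x := by
  have hsq : ∑' n, x n ^ 2 = ∑' n, y n ^ 2 := by
    have := congrArg (· ^ 2) hxy
    simpa only [l2Norm, Real.sq_sqrt (tsum_nonneg fun n => sq_nonneg (x n)),
      Real.sq_sqrt (tsum_nonneg fun n => sq_nonneg (y n))] using this
  have hadd : ∑' n, (x + y) n ^ 2 = ∑' n, x n ^ 2 + ∑' n, y n ^ 2 := by
    rw [← hx.summable_sq.tsum_add hy.summable_sq]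
    congr 1
    funext n
    rcases hd n with h | h <;> simp [h]
  rw [l2Norm, l2Norm, hadd, ← hsq, ← two_mul, Real.sqrt_mul (by norm_num)]

lemma FinSupp.l2Norm_pos {x : ℕ → ℝ} (hx : FinSupp x) {n : ℕ} (hn : x n ≠ 0) :
    0 < l2Norm x :=
  Real.sqrt_pos.2 (hx.summable_sq.tsum_pos (fun _ => sq_nonneg _) n (by positivity))

lemma KP2_add_of_disjoint {x y : ℕ → ℝ} (hx : FinSupp x) (hy : FinSupp y)
    (hd : ∀ n, x n = 0 ∨ y n = 0) (hxy : l2Norm x = l2Norm y) :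
    KP2 (x + y) - KP2 x - KP2 y = Real.log (Real.sqrt 2) • (x + y) := by
  have key : ∀ s a : ℝ, 0 < s → a ≠ 0 → Real.log (Real.sqrt 2 * s / |a|)
      = Real.log (Real.sqrt 2) + Real.log (s / |a|) := fun s a hs ha => by
    rw [mul_div_assoc, Real.log_mul (by positivity) (by positivity)]
  funext n
  simp only [KP2, Pi.sub_apply, Pi.smul_apply, smul_eq_mul,
    l2Norm_add_of_disjoint hx hy hd hxy, Pi.add_apply]
  rcases hd n with h | h
  · by_cases h' : y n = 0
    · simp [h, h']
    · simp only [h, h', zero_add, if_true, if_false, hxy, key _ _ (hy.l2Norm_pos h') h']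
      ring
  · by_cases h' : x n = 0
    · simp [h, h']
    · simp only [h, h', add_zero, if_true, if_false, key _ _ (hx.l2Norm_pos h') h']
      ring

/-- The average of `ε · F (ε · x)` over all sign changes `ε` on the finite set `S`. -/
noncomputable def signAverage (F : (ℕ → ℝ) → (ℕ → ℝ)) (S : Finset ℕ) (x : ℕ → ℝ) (n : ℕ) : ℝ :=
  (2 ^ #S : ℝ)⁻¹ * ∑ A ∈ S.powerset, flipSign A n * F (flipSign A * x) n

section signAverage

variable {F : (ℕ → ℝ) → (ℕ → ℝ)} {S : Finset ℕ} {x : ℕ → ℝ} {a n : ℕ}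

lemma signAverage_insert_of_ne (ha : a ∉ S) (hx : x a = 0) (hn : n ≠ a) :
    signAverage F (insert a S) x n = signAverage F S x n := by
  simp only [signAverage, sum_powerset_insert ha, flipSign_insert_of_ne hn,
    flipSign_insert_mul hx, card_insert_of_notMem ha, pow_succ]
  field_simp
  ring

lemma signAverage_eq_zero (hn : n ∈ S) (hx : x n = 0) : signAverage F S x n = 0 := by
  rw [← insert_erase hn, signAverage, sum_powerset_insert (notMem_erase n S), ← sum_add_distrib,
    sum_eq_zero, mul_zero]
  intro A hA
  have hnA : n ∉ A := fun h => notMem_erase n S (mem_powerset.1 hA h)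
  rw [flipSign_insert_mul hx]
  simp [flipSign, hnA]

lemma signAverage_eq_of_subset {T : Finset ℕ} (hST : S ⊆ T) (hx : ∀ a ∈ T, a ∉ S → x a = 0)
    (hn : n ∈ S) : signAverage F T x n = signAverage F S x n := by
  induction T using Finset.strongInduction with
  | H T ih =>
    rcases hST.eq_or_ssubset with rfl | h
    · rfl
    · obtain ⟨a, haT, haS⟩ := exists_of_ssubset h
      rw [← ih (T.erase a) (erase_ssubset haT) (subset_erase.2 ⟨hST, haS⟩)
        fun b hb => hx b (mem_of_mem_erase hb)]
      conv_lhs => rw [← insert_erase haT]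
      exact signAverage_insert_of_ne (notMem_erase a T) (hx a haT haS)
        fun hna => haS (hna ▸ hn)

end signAverage

/-- The sign-symmetrization of `F`, restricted to the support of the argument. -/
noncomputable def signSymmetrization (F : (ℕ → ℝ) → (ℕ → ℝ)) (x : ℕ → ℝ) (n : ℕ) : ℝ :=
  open Classical in
  if h : FinSupp x ∧ x n ≠ 0 then signAverage F h.1.toFinset x n else 0

lemma signSymmetrization_eq_zero {F : (ℕ → ℝ) → (ℕ → ℝ)} {x : ℕ → ℝ} {n : ℕ} (hn : x n = 0) :
    signSymmetrization F x n = 0 := by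
  simp [signSymmetrization, hn]

lemma signSymmetrization_eq_signAverage {F : (ℕ → ℝ) → (ℕ → ℝ)} {x : ℕ → ℝ} (hx : FinSupp x)
    {S : Finset ℕ} (hS : ∀ m, x m ≠ 0 → m ∈ S) {n : ℕ} (hn : n ∈ S) :
    signSymmetrization F x n = signAverage F S x n := by
  by_cases h : x n = 0
  · rw [signSymmetrization_eq_zero h, signAverage_eq_zero hn h]
  · rw [signSymmetrization, dif_pos ⟨hx, h⟩]
    refine (signAverage_eq_of_subset (fun m hm => hS m ?_) (fun m _ hm => ?_) ?_).symm
    · exact (Set.Finite.mem_toFinset hx).1 hm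
    · exact not_not.1 fun h0 => hm ((Set.Finite.mem_toFinset hx).2 h0)
    · exact (Set.Finite.mem_toFinset hx).2 h

lemma signSymmetrization_smul {F : (ℕ → ℝ) → (ℕ → ℝ)}
    (hF : ∀ (c : ℝ) (x : ℕ → ℝ), FinSupp x → F (c • x) = c • F x)
    (c : ℝ) {x : ℕ → ℝ} (hx : FinSupp x) :
    signSymmetrization F (c • x) = c • signSymmetrization F x := by
  have hcx : FinSupp (c • x) := hx.subset (support_const_smul_subset c x)
  funext n
  by_cases h : x n = 0
  · simp [signSymmetrization_eq_zero, h]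
  · have hS : ∀ m, x m ≠ 0 → m ∈ hx.toFinset := fun m hm =>
      (Set.Finite.mem_toFinset hx).2 hm
    rw [signSymmetrization_eq_signAverage hcx (S := hx.toFinset)
      (fun m hm => hS m fun h0 => hm (by simp [h0])) (hS n h), Pi.smul_apply,
      signSymmetrization_eq_signAverage hx hS (hS n h), smul_eq_mul, signAverage, signAverage,
      mul_left_comm]
    refine congrArg _ ?_
    rw [mul_sum]
    refine sum_congr rfl fun A _ => ?_
    rw [mul_smul_comm, hF c _ (hx.mul_left _), Pi.smul_apply, smul_eq_mul, mul_left_comm]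

/-- Averaging finitely many sequences, up to signs, does not increase a common `ℓ₂` bound. -/
lemma l2Norm_le_of_eq_average {f : ℕ → ℝ} {S : Finset ℕ} {g : Finset ℕ → ℕ → ℝ} {C : ℝ}
    (hf : ∀ n ∉ S, f n = 0)
    (hfg : ∀ n ∈ S, f n = (2 ^ #S : ℝ)⁻¹ * ∑ A ∈ S.powerset, flipSign A n * g A n)
    (hg : ∀ A, Summable fun n => g A n ^ 2) (hgC : ∀ A, l2Norm (g A) ≤ C) :
    l2Norm f ≤ C := by
  have hC : 0 ≤ C := (Real.sqrt_nonneg _).trans (hgC ∅)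
  rw [l2Norm, tsum_eq_sum (s := S) fun n hn => by simp [hf n hn]]
  refine Real.sqrt_le_iff.2 ⟨hC, ?_⟩
  have hpt : ∀ n ∈ S, f n ^ 2 ≤ (2 ^ #S : ℝ)⁻¹ * ∑ A ∈ S.powerset, g A n ^ 2 := by
    intro n hn
    have h := sq_sum_le_card_mul_sum_sq (s := S.powerset) (f := fun A => flipSign A n * g A n)
    simp only [mul_pow, flipSign_sq, one_mul, card_powerset, Nat.cast_pow, Nat.cast_ofNat] at h
    rw [hfg n hn, mul_pow, sq (2 ^ #S : ℝ)⁻¹, mul_assoc]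
    refine mul_le_mul_of_nonneg_left ?_ (by positivity)
    rwa [inv_mul_le_iff₀ (by positivity)]
  refine (sum_le_sum hpt).trans ?_
  rw [← mul_sum, sum_comm, inv_mul_le_iff₀ (by positivity)]
  have := sum_le_card_nsmul S.powerset (fun A => ∑ n ∈ S, g A n ^ 2) (C ^ 2) fun A _ =>
    (sum_sq_le_l2Norm_sq (hg A) S).trans (pow_le_pow_left₀ (Real.sqrt_nonneg _) (hgC A) 2)
  simpa [card_powerset] using this


/-- Let `Φ : c00 → c00` be a homogeneous map commuting with all sign
sequences. If there are a homogeneous `H₀ : c00 → ℓ₂` and a constant `K₀` such that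
`‖H₀(x+x') − H₀(x) − H₀(x') − Φ(Ω(x+x') − Ω(x) − Ω(x'))‖₂ ≤ K₀(‖x‖₂ + ‖x'‖₂)` on `c00`,
where `Ω` is the Kalton–Peck map, then there are a homogeneous support-preserving map
`H : c00 → ℓ₂` and a constant `K` such that
`‖H(x+y) − H(x) − H(y) − Φ(x+y)‖₂ ≤ K‖x‖₂` whenever `x, y ∈ c00` have disjoint supports
and `‖x‖₂ = ‖y‖₂`. -/
theorem witness_for_disjoint_vectors
    (Φ : (ℕ → ℝ) → (ℕ → ℝ))
    (hΦ_c00 : ∀ x, FinSupp x → FinSupp (Φ x))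
    (hΦ_homog : ∀ (c : ℝ) (x : ℕ → ℝ), FinSupp x → Φ (c • x) = c • Φ x)
    (hΦ_sign : ∀ (ε x : ℕ → ℝ), IsSign ε → FinSupp x → Φ (ε * x) = ε * Φ x)
    (H₀ : (ℕ → ℝ) → (ℕ → ℝ))
    (hH₀_l2 : ∀ x, FinSupp x → Summable (fun n => (H₀ x n) ^ 2))
    (hH₀_homog : ∀ (c : ℝ) (x : ℕ → ℝ), FinSupp x → H₀ (c • x) = c • H₀ x)
    (K₀ : ℝ)
    (hK₀ : ∀ x x' : ℕ → ℝ, FinSupp x → FinSupp x' →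
      l2Norm (fun n => H₀ (x + x') n - H₀ x n - H₀ x' n
          - Φ (KP2 (x + x') - KP2 x - KP2 x') n)
        ≤ K₀ * (l2Norm x + l2Norm x')) :
    ∃ (H : (ℕ → ℝ) → (ℕ → ℝ)) (K : ℝ),
      (∀ x, FinSupp x → Summable (fun n => (H x n) ^ 2)) ∧
      (∀ (c : ℝ) (x : ℕ → ℝ), FinSupp x → H (c • x) = c • H x) ∧
      (∀ x : ℕ → ℝ, FinSupp x → ∀ n, x n = 0 → H x n = 0) ∧
      (∀ x y : ℕ → ℝ, FinSupp x → FinSupp y →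
        (∀ n, x n = 0 ∨ y n = 0) → l2Norm x = l2Norm y →
        l2Norm (fun n => H (x + y) n - H x n - H y n - Φ (x + y) n)
          ≤ K * l2Norm x) := by
  set c := Real.log (Real.sqrt 2)
  have hc : 0 < c := Real.log_pos (by
    rw [Real.lt_sqrt] <;> norm_num)
  have hdefect : ∀ x y : ℕ → ℝ, FinSupp x → FinSupp y → (∀ n, x n = 0 ∨ y n = 0) →
      l2Norm x = l2Norm y →
      l2Norm (fun n => H₀ (x + y) n - H₀ x n - H₀ y n - c * Φ (x + y) n)
        ≤ 2 * K₀ * l2Norm x := by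
    intro x y hx hy hd hxy
    have h := hK₀ x y hx hy
    rw [KP2_add_of_disjoint hx hy hd hxy, hΦ_homog _ _ (hx.add hy), ← hxy] at h
    exact h.trans_eq (by ring)
  refine ⟨fun x => c⁻¹ • signSymmetrization H₀ x, c⁻¹ * (2 * K₀), fun x hx => ?_,
    fun r x hx => ?_, fun x _ n hn => ?_, fun x y hx hy hd hxy => ?_⟩
  · refine FinSupp.summable_sq (hx.subset fun n hn h => hn ?_)
    simp [signSymmetrization_eq_zero h]
  · simp only [signSymmetrization_smul hH₀_homog r hx]
    exact smul_comm _ _ _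
  · simp [signSymmetrization_eq_zero hn]
  · have hxy_fin := hx.add hy
    let S : Finset ℕ := hx.toFinset ∪ hy.toFinset
    have hSx : ∀ m, x m ≠ 0 → m ∈ S := fun m hm =>
      mem_union_left _ ((Set.Finite.mem_toFinset hx).2 hm)
    have hSy : ∀ m, y m ≠ 0 → m ∈ S := fun m hm =>
      mem_union_right _ ((Set.Finite.mem_toFinset hy).2 hm)
    have hSxy : ∀ m, (x + y) m ≠ 0 → m ∈ S := fun m hm => by
      by_contra h
      exact hm (by simp [not_imp_comm.1 (hSx m) h, not_imp_comm.1 (hSy m) h])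
    refine l2Norm_le_of_eq_average (S := S)
      (g := fun A n => c⁻¹ * (H₀ (flipSign A * x + flipSign A * y) n - H₀ (flipSign A * x) n
        - H₀ (flipSign A * y) n - c * Φ (flipSign A * x + flipSign A * y) n))
      (fun n hn => ?_) (fun n hn => ?_) (fun A => ?_) (fun A => ?_)
    · have hxn := not_imp_comm.1 (hSx n) hn
      have hyn := not_imp_comm.1 (hSy n) hn
      have hxyn := not_imp_comm.1 (hSxy n) hn
      simp [signSymmetrization_eq_zero, hxn, hyn,
        eq_zero_of_commutes_signs hΦ_sign hxy_fin hxyn]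
    · have hΦ_avg : Φ (x + y) n = (2 ^ #S : ℝ)⁻¹ * ∑ A ∈ S.powerset,
          flipSign A n * Φ (flipSign A * (x + y)) n := by
        have : ∀ A ∈ S.powerset, flipSign A n * Φ (flipSign A * (x + y)) n = Φ (x + y) n := by
          intro A _
          rw [hΦ_sign _ _ (isSign_flipSign A) hxy_fin, Pi.mul_apply, ← mul_assoc,
            flipSign_mul_self, one_mul]
        rw [sum_congr rfl this]
        simp [card_powerset]
      simp only [Pi.smul_apply, smul_eq_mul]
      rw [signSymmetrization_eq_signAverage hxy_fin hSxy hn,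
        signSymmetrization_eq_signAverage hx hSx hn,
        signSymmetrization_eq_signAverage hy hSy hn, hΦ_avg]
      simp only [signAverage, mul_left_comm c⁻¹, ← mul_sub, mul_sum, ← sum_sub_distrib]
      refine sum_congr rfl fun A _ => ?_
      rw [mul_add]
      field_simp
    · simp only [mul_pow]
      have hxA := hx.mul_left (flipSign A)
      have hyA := hy.mul_left (flipSign A)
      have hΦA : Summable fun n => (c * Φ (flipSign A * x + flipSign A * y) n) ^ 2 := by
        simpa only [mul_pow] using (hΦ_c00 _ (hxA.add hyA)).summable_sq.mul_left (c ^ 2)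
      exact (summable_sq_sub (summable_sq_sub (summable_sq_sub (hH₀_l2 _ (hxA.add hyA))
        (hH₀_l2 _ hxA)) (hH₀_l2 _ hyA)) hΦA).mul_left _
    · have h := hdefect (flipSign A * x) (flipSign A * y) (hx.mul_left _) (hy.mul_left _)
        (fun n => (hd n).imp (by simp +contextual) (by simp +contextual))
        (by rw [l2Norm_sign_mul (isSign_flipSign A), l2Norm_sign_mul (isSign_flipSign A), hxy])
      rw [l2Norm_sign_mul (isSign_flipSign A)] at h
      rw [l2Norm_const_mul, abs_of_pos (inv_pos.2 hc), mul_assoc]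
      gcongr
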